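/- Let ≤ be a cylinder order on {0,1}^∞ with 0^∞ < 1^∞. Then either m_≤ = σ(10^∞) for some σ ∈ S*, or m_≤ = σ(1^∞) (the limit word lim_{n→∞} σ_{[1,n]}(1^∞)) for some σ = (σ_n)_{n≥1} ∈ S^∞. -/

import Mathlib

open scoped Classical

noncomputable section

/-- The ultrametric on infinite words: `d(a,b) = 2^{-min{n ≥ 1 : a_n ≠ b_n}}`
(words are indexed from 0 here, so position `i` corresponds to `n = i+1`). -/
noncomputable def wdist {A : Type*} [DecidableEq A] (a b : ℕ → A) : ℝ :=
  if h : ∃ n, a n ≠ b n then (2 : ℝ)⁻¹ ^ (Nat.find h + 1) else 0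

/-- The tail `a_{k+1} a_{k+2} ⋯` of an infinite word. -/
def shiftn {A : Type*} (a : ℕ → A) (k : ℕ) : ℕ → A := fun n => a (n + k)

/-- The set of tails of an infinite word (including the word itself). -/
def tails {A : Type*} (a : ℕ → A) : Set (ℕ → A) := {b | ∃ k, b = shiftn a k}

/-- A cylinder order: a total order such that `a ≤ b ≤ c` implies `d(a,b) ≤ d(a,c)`. -/
def IsCylOrder {A : Type*} [DecidableEq A] (le : (ℕ → A) → (ℕ → A) → Prop) : Prop :=
  (∀ a b, le a b ∨ le b a) ∧
  (∀ a b, le a b → le b a → a = b) ∧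
  (∀ a b c, le a b → le b c → le a c) ∧
  (∀ a b c, le a b → le b c → wdist a b ≤ wdist a c)

/-- Strict comparison associated to an order relation. -/
def wlt {A : Type*} (le : (ℕ → A) → (ℕ → A) → Prop) (a b : ℕ → A) : Prop :=
  le a b ∧ a ≠ b

/-- `m` is the least upper bound of the set `s` with respect to `le`. -/
def IsSupOf {A : Type*} (le : (ℕ → A) → (ℕ → A) → Prop) (s : Set (ℕ → A))
    (m : ℕ → A) : Prop :=
  (∀ x ∈ s, le x m) ∧ ∀ b, (∀ x ∈ s, le x b) → le m b

/-- The set `M_≤ = {s_≤(a) : a ∈ A^∞}` of sup-words. -/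
def supWords {A : Type*} (le : (ℕ → A) → (ℕ → A) → Prop) : Set (ℕ → A) :=
  {m | ∃ a, IsSupOf le (tails a) m}

/-- `x` is an accumulation point of `M` in the metric `wdist`. -/
def IsAccPt' {A : Type*} [DecidableEq A] (M : Set (ℕ → A)) (x : ℕ → A) : Prop :=
  ∀ ε : ℝ, 0 < ε → ∃ y ∈ M, y ≠ x ∧ wdist x y < ε

/-- `x` is the smallest (w.r.t. `le`) accumulation point of `M`. -/
def IsSmallestAcc {A : Type*} [DecidableEq A] (le : (ℕ → A) → (ℕ → A) → Prop)
    (M : Set (ℕ → A)) (x : ℕ → A) : Prop :=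
  IsAccPt' M x ∧ ∀ y, IsAccPt' M y → le x y

/-- Membership in the cylinder given by the finite word `w`. -/
def inCyl {A : Type*} (w : List A) (a : ℕ → A) : Prop :=
  ∀ i : Fin w.length, a i.val = w.get i

/-- `[u] < [v]` for cylinders: every element of `[u]` is strictly below every element of `[v]`. -/
def cylLt {A : Type*} (le : (ℕ → A) → (ℕ → A) → Prop) (u v : List A) : Prop :=
  ∀ a b, inCyl u a → inCyl v b → wlt le a b

/-- Infinite binary words. -/
abbrev W2 := ℕ → Bool

/-- The word `0^∞`. -/
def w0 : W2 := fun _ => false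

/-- The word `1^∞`. -/
def w1 : W2 := fun _ => true

/-- The word `10^∞`. -/
def w10inf : W2 := fun n => decide (n = 0)

/-- The periodic word `w^∞` for a finite word `w`. -/
def perW (w : List Bool) : W2 := fun n => w.getD (n % w.length) false

/-- A substitution on `{0,1}`, given by the images of the two letters. -/
abbrev Sub2 := Bool → List Bool

/-- Action of a substitution on finite words. -/
def listApply (f : Sub2) (l : List Bool) : List Bool := (l.map f).flatten

/-- Action of a (nonerasing) substitution on infinite words. -/
def subApply (f : Sub2) (a : W2) : W2 :=
  fun n => (listApply f (List.ofFn (fun i : Fin (n + 1) => a i.val))).getD n false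

/-- The substitution `τ_{j,k} : 0 ↦ 10^j, 1 ↦ 10^k`. -/
def tauS (j k : ℕ) : Sub2 := fun b => true :: List.replicate (if b then k else j) false

/-- Membership in the set `S = {τ_{j,k} : 0 ≤ j < k}`. -/
def memS (f : Sub2) : Prop := ∃ j k : ℕ, j < k ∧ f = tauS j k

/-- Apply a finite composition `σ_1 ∘ ⋯ ∘ σ_n` (given as a list) to an infinite word. -/
def applyList (L : List Sub2) (a : W2) : W2 := L.foldr subApply a

/-- Apply a finite composition `σ_1 ∘ ⋯ ∘ σ_n` (given as a list) to a finite word. -/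
def listApplyL (L : List Sub2) (l : List Bool) : List Bool := L.foldr listApply l

/-- `σ_{[1,n]} = σ_1 ∘ ⋯ ∘ σ_n` applied to an infinite word, for `σ ∈ S^∞`
(indexed from 0 in Lean). -/
def compUpTo (σ : ℕ → Sub2) (n : ℕ) (a : W2) : W2 :=
  applyList (List.ofFn (fun i : Fin n => σ i.val)) a

/-- `m` is the limit word `lim_{n → ∞} σ_{[1,n]}(a)`. -/
def IsLimitWord (σ : ℕ → Sub2) (a m : W2) : Prop :=
  ∀ ε : ℝ, 0 < ε → ∃ N : ℕ, ∀ n ≥ N, wdist (compUpTo σ n a) m < ε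

/-! ### Common prefixes and the metric -/

/-- The words `a` and `b` have the same first `n` letters. -/
def Agree {A : Type*} (n : ℕ) (a b : ℕ → A) : Prop := ∀ i < n, a i = b i

theorem Agree.symm {A : Type*} {n : ℕ} {a b : ℕ → A} (h : Agree n a b) : Agree n b a :=
  fun i hi => (h i hi).symm

theorem Agree.trans {A : Type*} {n : ℕ} {a b c : ℕ → A} (h : Agree n a b) (h' : Agree n b c) :
    Agree n a c :=
  fun i hi => (h i hi).trans (h' i hi)

theorem Agree.mono {A : Type*} {m n : ℕ} {a b : ℕ → A} (h : Agree n a b) (hmn : m ≤ n) :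
    Agree m a b :=
  fun i hi => h i (by omega)

theorem Agree.shiftn {A : Type*} {n k : ℕ} {a b : ℕ → A} (h : Agree (n + k) a b) :
    Agree n (shiftn a k) (shiftn b k) :=
  fun i hi => h (i + k) (by omega)

theorem shiftn_zero {A : Type*} (a : ℕ → A) : shiftn a 0 = a := rfl

theorem shiftn_shiftn {A : Type*} (a : ℕ → A) (m n : ℕ) :
    shiftn (shiftn a m) n = shiftn a (n + m) := by
  funext i
  simp only [shiftn, Nat.add_assoc]

theorem wdist_lt_iff {A : Type*} [DecidableEq A] (a b : ℕ → A) (n : ℕ) :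
    wdist a b < (2 : ℝ)⁻¹ ^ n ↔ Agree n a b := by
  unfold wdist
  split_ifs with h
  · rw [pow_lt_pow_iff_right_of_lt_one₀ (by norm_num) (by norm_num)]
    constructor
    · intro hn i hi
      exact not_not.mp (Nat.find_min h (by omega))
    · intro hn
      by_contra hlt
      exact Nat.find_spec h (hn _ (by omega))
  · push Not at h
    exact ⟨fun _ i _ => h i, fun _ => by positivity⟩

theorem wdist_le_iff {A : Type*} [DecidableEq A] (a b c : ℕ → A) :
    wdist a b ≤ wdist a c ↔ ∀ n, Agree n a c → Agree n a b := by
  constructor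
  · intro h n hn
    exact (wdist_lt_iff a b n).mp (h.trans_lt ((wdist_lt_iff a c n).mpr hn))
  · intro h
    by_contra! hlt
    by_cases hab : ∃ n, a n ≠ b n
    · have hw : wdist a b = (2 : ℝ)⁻¹ ^ (Nat.find hab + 1) := by simp only [wdist, dif_pos hab]
      exact Nat.find_spec hab (h _ ((wdist_lt_iff a c _).mp (hw ▸ hlt)) _ (Nat.lt_succ_self _))
    · have hw : wdist a b = 0 := by simp only [wdist, dif_neg hab]
      have hc : 0 ≤ wdist a c := by
        unfold wdist
        split_ifs <;> positivity
      exact absurd hlt (by rw [hw]; exact not_lt.mpr hc)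

theorem isAccPt'_iff {A : Type*} [DecidableEq A] (M : Set (ℕ → A)) (x : ℕ → A) :
    IsAccPt' M x ↔ ∀ n, ∃ y ∈ M, y ≠ x ∧ Agree n x y := by
  constructor
  · intro h n
    obtain ⟨y, hy, hne, hd⟩ := h ((2 : ℝ)⁻¹ ^ n) (by positivity)
    exact ⟨y, hy, hne, (wdist_lt_iff x y n).mp hd⟩
  · intro h ε hε
    obtain ⟨n, hn⟩ := exists_pow_lt_of_lt_one hε (by norm_num : (2 : ℝ)⁻¹ < 1)
    obtain ⟨y, hy, hne, hd⟩ := h n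
    exact ⟨y, hy, hne, ((wdist_lt_iff x y n).mpr hd).trans hn⟩

theorem mem_closure_iff_agree (s : Set W2) (x : W2) :
    x ∈ closure s ↔ ∀ n, ∃ y ∈ s, Agree n x y := by
  rw [(PiNat.isTopologicalBasis_cylinders (fun _ : ℕ => Bool)).mem_closure_iff]
  constructor
  · intro h n
    obtain ⟨y, hy, hys⟩ := h (PiNat.cylinder x n) ⟨x, n, rfl⟩ (PiNat.self_mem_cylinder x n)
    exact ⟨y, hys, fun i hi => (hy i hi).symm⟩
  · rintro h _ ⟨z, n, rfl⟩ hx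
    obtain ⟨y, hys, hy⟩ := h n
    exact ⟨y, fun i hi => (hy i hi).symm.trans (hx i hi), hys⟩

theorem isClosed_of_agree (s : Set W2) (h : ∀ x, (∀ n, ∃ y ∈ s, Agree n x y) → x ∈ s) :
    IsClosed s :=
  isClosed_of_closure_subset fun x hx => h x ((mem_closure_iff_agree s x).mp hx)

/-! ### Cylinder orders -/

namespace IsCylOrder

section General

variable {A : Type*} [DecidableEq A] {le : (ℕ → A) → (ℕ → A) → Prop}

theorem refl (h : IsCylOrder le) (a : ℕ → A) : le a a := (h.1 a a).elim id id

theorem agree_of_between (h : IsCylOrder le) {a b c : ℕ → A} (hab : le a b) (hbc : le b c)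
    {n : ℕ} (hac : Agree n a c) : Agree n a b :=
  (wdist_le_iff a b c).mp (h.2.2.2 a b c hab hbc) n hac

theorem flip (h : IsCylOrder le) : IsCylOrder (fun a b => le b a) := by
  refine ⟨fun a b => h.1 b a, fun a b hab hba => h.2.1 a b hba hab,
    fun a b c hab hbc => h.2.2.1 c b a hbc hab, fun a b c hab hbc => ?_⟩
  rw [wdist_le_iff]
  intro n hac
  exact hac.trans (h.agree_of_between hbc hab hac.symm)

/-- A strict comparison only depends on the letters up to a difference. -/
theorem le_of_agree (h : IsCylOrder le) {a b a' b' : ℕ → A} {p : ℕ} (hab : le a b)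
    (hne : a p ≠ b p) (ha : Agree (p + 1) a a') (hb : Agree (p + 1) b b') :
    le a' b' ∧ a' ≠ b' := by
  have hne' : a' p ≠ b' p := by
    rw [← ha p (by omega), ← hb p (by omega)]
    exact hne
  have h1 : le a' b := by
    refine (h.1 a' b).resolve_right fun hba => hne ?_
    exact h.agree_of_between hab hba ha p (by omega)
  refine ⟨(h.1 a' b').resolve_right fun hba => hne' ?_, fun he => hne' (congrFun he p)⟩
  exact (h.agree_of_between hba h1 hb.symm p (by omega)).symm

theorem not_le (h : IsCylOrder le) {a b : ℕ → A} (hab : ¬ le a b) : le b a ∧ b ≠ a :=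
  ⟨(h.1 a b).resolve_left hab, fun he => hab (he ▸ h.refl _)⟩

theorem not_le_of_lt (h : IsCylOrder le) {a b : ℕ → A} (hab : le a b ∧ a ≠ b) : ¬ le b a :=
  fun hba => hab.2 (h.2.1 _ _ hab.1 hba)

end General

variable {le : W2 → W2 → Prop}

theorem isClosed_setOf_le (h : IsCylOrder le) (y : W2) : IsClosed {x | le x y} := by
  refine isClosed_of_agree _ fun x hx => ?_
  by_contra hxy
  obtain ⟨hyx, hne⟩ := h.not_le hxy
  obtain ⟨p, hpne⟩ := Function.ne_iff.mp hne
  obtain ⟨z, hz, hxz⟩ := hx (p + 1)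
  exact h.not_le_of_lt (h.le_of_agree hyx hpne (fun _ _ => rfl) hxz) hz

theorem exists_least (h : IsCylOrder le) {K : Set W2} (hK : IsClosed K) (hne : K.Nonempty) :
    ∃ m ∈ K, ∀ y ∈ K, le m y := by
  have : Nonempty K := hne.to_subtype
  have hclosed : ∀ y : K, IsClosed (K ∩ {x | le x y}) :=
    fun y => hK.inter (h.isClosed_setOf_le y)
  obtain ⟨m, hm⟩ := IsCompact.nonempty_iInter_of_directed_nonempty_isCompact_isClosed
    (fun y : K => K ∩ {x | le x y}) (by
      intro y z
      rcases h.1 y z with hyz | hzy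
      · exact ⟨y, subset_rfl, fun x hx => ⟨hx.1, h.2.2.1 _ _ _ hx.2 hyz⟩⟩
      · exact ⟨z, fun x hx => ⟨hx.1, h.2.2.1 _ _ _ hx.2 hzy⟩, subset_rfl⟩)
    (fun y => ⟨y, y.2, h.refl _⟩) (fun y => (hclosed y).isCompact) hclosed
  rw [Set.mem_iInter] at hm
  exact ⟨m, (hm (Classical.arbitrary K)).1, fun y hy => (hm ⟨y, hy⟩).2⟩

theorem mem_closure_of_isSupOf (h : IsCylOrder le) {s : Set W2} (hs : s.Nonempty) {x : W2}
    (hx : IsSupOf le s x) : x ∈ closure s := by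
  obtain ⟨m, hm, hmax⟩ := h.flip.exists_least (K := closure s) isClosed_closure hs.closure
  have h1 : le x m := hx.2 m fun y hy => hmax y (subset_closure hy)
  have h2 : le m x := closure_minimal hx.1 (h.isClosed_setOf_le x) hm
  exact h.2.1 _ _ h1 h2 ▸ hm

theorem mem_supWords_iff (h : IsCylOrder le) (x : W2) :
    x ∈ supWords le ↔ ∀ n, le (shiftn x n) x := by
  constructor
  · rintro ⟨a, ha⟩ n
    by_contra hn
    obtain ⟨hlt, hne⟩ := h.not_le hn
    obtain ⟨p, hpne⟩ := Function.ne_iff.mp hne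
    have hcl := h.mem_closure_of_isSupOf (s := tails a) ⟨a, 0, rfl⟩ ha
    obtain ⟨_, ⟨k, rfl⟩, hk⟩ := (mem_closure_iff_agree _ x).mp hcl (p + 1 + n)
    refine h.not_le_of_lt (h.le_of_agree hlt hpne (fun _ _ => rfl) hk.shiftn) (ha.1 _ ⟨n + k, ?_⟩)
    rw [shiftn_shiftn]
  · intro hx
    refine ⟨x, ?_, fun b hb => hb x ⟨0, rfl⟩⟩
    rintro _ ⟨k, rfl⟩
    exact hx k

theorem isClosed_supWords (h : IsCylOrder le) : IsClosed (supWords le) := by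
  refine isClosed_of_agree _ fun x hx => (h.mem_supWords_iff x).mpr fun n => ?_
  by_contra hn
  obtain ⟨hlt, hne⟩ := h.not_le hn
  obtain ⟨p, hpne⟩ := Function.ne_iff.mp hne
  obtain ⟨z, hz, hxz⟩ := hx (p + 1 + n)
  exact h.not_le_of_lt
    (h.le_of_agree hlt hpne (hxz.mono (by omega)) hxz.shiftn)
    ((h.mem_supWords_iff z).mp hz n)

theorem mem_supWords_of_isAccPt' (h : IsCylOrder le) {x : W2} (hx : IsAccPt' (supWords le) x) :
    x ∈ supWords le := by
  rw [← h.isClosed_supWords.closure_eq, mem_closure_iff_agree]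
  intro n
  obtain ⟨y, hy, -, hxy⟩ := (isAccPt'_iff _ x).mp hx n
  exact ⟨y, hy, hxy⟩

theorem isClosed_setOf_isAccPt' (M : Set W2) : IsClosed {x | IsAccPt' M x} := by
  refine isClosed_of_agree _ fun x hx => (isAccPt'_iff M x).mpr fun n => ?_
  by_contra! hn
  obtain ⟨y, hy, hxy⟩ := hx n
  by_cases hyx : y = x
  · subst hyx
    obtain ⟨z, hz, hne, hyz⟩ := (isAccPt'_iff M y).mp hy n
    exact hn z hz hne hyz
  · obtain ⟨p, hpne⟩ := Function.ne_iff.mp hyx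
    obtain ⟨z, hz, -, hyz⟩ := (isAccPt'_iff M y).mp hy (max n (p + 1))
    refine hn z hz (fun he => hpne ?_) (hxy.trans (hyz.mono (le_max_left _ _)))
    rw [← he]
    exact hyz p (by omega)

variable (h : IsCylOrder le) (h01 : wlt le w0 w1)
include h h01

theorem lt_of_head {x y : W2} (hx : x 0 = false) (hy : y 0 = true) : le x y ∧ x ≠ y := by
  refine h.le_of_agree (p := 0) h01.1 (by simp [w0, w1]) ?_ ?_
  · intro i hi
    obtain rfl : i = 0 := by omega
    exact hx.symm
  · intro i hi
    obtain rfl : i = 0 := by omega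
    exact hy.symm

theorem mem_supWords_of_tails {x : W2} (hx : x 0 = true)
    (ht : ∀ n, x n = true → le (shiftn x n) x) : x ∈ supWords le := by
  refine (h.mem_supWords_iff x).mpr fun n => ?_
  by_cases hn : x n = true
  · exact ht n hn
  · exact (h.lt_of_head h01 (by simpa [shiftn] using hn) hx).1

theorem head_of_isAccPt' {x : W2} (hx : IsAccPt' (supWords le) x) : x 0 = true := by
  by_contra h0
  rw [Bool.not_eq_true] at h0
  have key : ∀ y ∈ supWords le, y 0 = false → y = w0 := by
    intro y hy hy0
    funext n
    by_contra hn
    have hn' : y n = true := by simpa [w0] using hn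
    exact h.not_le_of_lt (h.lt_of_head h01 hy0 (y := shiftn y n) (by simpa [shiftn] using hn'))
      ((h.mem_supWords_iff y).mp hy n)
  obtain ⟨y, hy, hne, hxy⟩ := (isAccPt'_iff _ x).mp hx 1
  refine hne ((key y hy ?_).trans (key x (h.mem_supWords_of_isAccPt' hx) h0).symm)
  rw [← hxy 0 one_pos, h0]

end IsCylOrder

/-! ### Blocks -/

/-- The word `x` starts with `10^n`. -/
def StartsZeros (n : ℕ) (x : W2) : Prop := x 0 = true ∧ ∀ i, 1 ≤ i → i ≤ n → x i = false

/-- The word `x` starts with `10^n1`. -/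
def StartsBlock (n : ℕ) (x : W2) : Prop := StartsZeros n x ∧ x (n + 1) = true

theorem StartsZeros.mono {m n : ℕ} {x : W2} (h : StartsZeros n x) (hmn : m ≤ n) :
    StartsZeros m x :=
  ⟨h.1, fun i h1 hi => h.2 i h1 (by omega)⟩

theorem startsZeros_w10inf (n : ℕ) : StartsZeros n w10inf :=
  ⟨by simp [w10inf], fun i h1 _ => by simp [w10inf]; omega⟩

theorem StartsZeros.agree {n : ℕ} {x y : W2} (hx : StartsZeros n x) (hy : StartsZeros n y) :
    Agree (n + 1) x y := by
  intro i hi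
  rcases Nat.eq_zero_or_pos i with rfl | hpos
  · rw [hx.1, hy.1]
  · rw [hx.2 i hpos (by omega), hy.2 i hpos (by omega)]

theorem StartsBlock.agree {n : ℕ} {x y : W2} (hx : StartsBlock n x) (hy : StartsBlock n y) :
    Agree (n + 2) x y := by
  intro i hi
  rcases Nat.lt_or_ge i (n + 1) with hlt | hge
  · exact hx.1.agree hy.1 i hlt
  · obtain rfl : i = n + 1 := by omega
    rw [hx.2, hy.2]

theorem StartsBlock.of_agree {n : ℕ} {x y : W2} (hx : StartsBlock n x) (h : Agree (n + 2) x y) :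
    StartsBlock n y :=
  ⟨⟨by rw [← h 0 (by omega), hx.1.1], fun i h1 hi => by rw [← h i (by omega), hx.1.2 i h1 hi]⟩,
    by rw [← h (n + 1) (by omega), hx.2]⟩

theorem StartsBlock.eq {m n : ℕ} {x : W2} (hm : StartsBlock m x) (hn : StartsBlock n x) :
    m = n := by
  rcases lt_trichotomy m n with hlt | rfl | hlt
  · have := hn.1.2 (m + 1) (by omega) (by omega)
    rw [hm.2] at this
    cases this
  · rfl
  · have := hm.1.2 (n + 1) (by omega) (by omega)
    rw [hn.2] at this
    cases this

theorem eq_w10inf_or_startsBlock {x : W2} (hx : x 0 = true) :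
    x = w10inf ∨ ∃ n, StartsBlock n x := by
  by_cases hex : ∃ n, x (n + 1) = true
  · refine Or.inr ⟨Nat.find hex, ⟨hx, fun i h1 hi => ?_⟩, Nat.find_spec hex⟩
    have := Nat.find_min hex (m := i - 1) (by omega)
    rw [Nat.sub_add_cancel h1] at this
    simpa using this
  · push Not at hex
    left
    funext i
    cases i with
    | zero => simpa [w10inf] using hx
    | succ n => simpa [w10inf] using hex n

/-- A word in `{10^n}^∞` is determined by `n`. -/
theorem eq_of_forall_startsBlock {n : ℕ} {x y : W2} (hx0 : x 0 = true) (hy0 : y 0 = true)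
    (hx : ∀ i, x i = true → StartsBlock n (shiftn x i))
    (hy : ∀ i, y i = true → StartsBlock n (shiftn y i)) : x = y := by
  funext i
  induction i using Nat.strong_induction_on generalizing x y with
  | _ i ih =>
    have hbx := hx 0 hx0
    have hby := hy 0 hy0
    rcases Nat.lt_or_ge i (n + 1) with hlt | hge
    · exact hbx.agree hby i (by omega)
    · have key := ih (i - (n + 1)) (by omega) (x := shiftn x (n + 1)) (y := shiftn y (n + 1))
        (by simpa [shiftn] using hbx.2) (by simpa [shiftn] using hby.2)
        (fun p hp => by rw [shiftn_shiftn]; exact hx _ hp)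
        (fun p hp => by rw [shiftn_shiftn]; exact hy _ hp)
      simpa only [shiftn, Nat.sub_add_cancel hge] using key

/-- The cylinder of `10^n1` lies below that of `10^{n+1}`. -/
def BlockUp (le : W2 → W2 → Prop) (n : ℕ) : Prop :=
  le (fun i => decide (i = 0 ∨ i = n + 1)) w10inf

theorem startsBlock_witness (n : ℕ) :
    StartsBlock n (fun i => decide (i = 0 ∨ i = n + 1)) :=
  ⟨⟨by simp, fun i h1 hi => by simp; omega⟩, by simp⟩

namespace IsCylOrder

variable {le : W2 → W2 → Prop} (h : IsCylOrder le)
include h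

theorem lt_of_blockUp {n : ℕ} (hn : BlockUp le n) {x y : W2} (hx : StartsBlock n x)
    (hy : StartsZeros (n + 1) y) : le x y ∧ x ≠ y :=
  h.le_of_agree (p := n + 1) hn (by simp [w10inf])
    ((startsBlock_witness n).agree hx) ((startsZeros_w10inf (n + 1)).agree hy)

theorem lt_of_not_blockUp {n : ℕ} (hn : ¬ BlockUp le n) {x y : W2} (hx : StartsBlock n x)
    (hy : StartsZeros (n + 1) y) : le y x ∧ y ≠ x :=
  h.le_of_agree (p := n + 1) (h.not_le hn).1 (by simp [w10inf])
    ((startsZeros_w10inf (n + 1)).agree hy) ((startsBlock_witness n).agree hx)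

theorem lt_of_not_startsBlock {j k : ℕ} (hk : BlockUp le k)
    (hlow : ∀ i < k, i ≠ j → ¬ BlockUp le i) {x y : W2} (hx : StartsBlock k x) (hy0 : y 0 = true)
    (hyj : ¬ StartsBlock j y) (hyk : ¬ StartsBlock k y) : le x y ∧ x ≠ y := by
  rcases eq_w10inf_or_startsBlock hy0 with rfl | ⟨n, hn⟩
  · exact h.lt_of_blockUp hk hx (startsZeros_w10inf _)
  · rcases lt_trichotomy n k with hlt | rfl | hlt
    · exact h.lt_of_not_blockUp (hlow n hlt fun he => hyj (he ▸ hn)) hn (hx.1.mono hlt)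
    · exact absurd hn hyk
    · exact h.lt_of_blockUp hk hx (hn.1.mono hlt)

theorem startsBlock_of_mem_supWords {j k : ℕ} (hk : BlockUp le k)
    (hlow : ∀ i < k, i ≠ j → ¬ BlockUp le i) {x : W2} (hx : x ∈ supWords le)
    (hxk : StartsBlock k x) (i : ℕ) (hi : x i = true) :
    StartsBlock j (shiftn x i) ∨ StartsBlock k (shiftn x i) := by
  by_contra! hc
  exact h.not_le_of_lt
    (h.lt_of_not_startsBlock hk hlow hxk (by simpa [shiftn] using hi) hc.1 hc.2)
    ((h.mem_supWords_iff x).mp hx i)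

theorem not_isAccPt'_of_startsBlock {j : ℕ} (hj : BlockUp le j)
    (hlow : ∀ i < j, ¬ BlockUp le i) {x : W2} (hxj : StartsBlock j x) :
    ¬ IsAccPt' (supWords le) x := by
  intro hx
  obtain ⟨z, hz, hne, hxz⟩ := (isAccPt'_iff _ x).mp hx (j + 2)
  have hzj := hxj.of_agree hxz
  refine hne (eq_of_forall_startsBlock hzj.1.1 hxj.1.1 (n := j) (fun i hi => ?_) fun i hi => ?_)
  · exact (h.startsBlock_of_mem_supWords hj (fun i hi _ => hlow i hi) hz hzj i hi).elim id id
  · exact (h.startsBlock_of_mem_supWords hj (fun i hi _ => hlow i hi)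
      (h.mem_supWords_of_isAccPt' hx) hxj i hi).elim id id

theorem isAccPt'_w10inf (h01 : wlt le w0 w1) : IsAccPt' (supWords le) w10inf := by
  refine (isAccPt'_iff _ _).mpr fun n => ⟨fun i => decide (i % (n + 1) = 0), ?_, ?_, ?_⟩
  · refine h.mem_supWords_of_tails h01 (by simp) fun i hi => ?_
    have hs : shiftn (fun i => decide (i % (n + 1) = 0)) i = fun i => decide (i % (n + 1) = 0) := by
      funext p
      have hd : i % (n + 1) = 0 := by simpa using hi
      simp [shiftn, Nat.add_mod, hd]
    rw [hs]
    exact h.refl _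
  · intro he
    have := congrFun he (n + 1)
    simp [w10inf] at this
  · intro i hi
    simp [w10inf, Nat.mod_eq_of_lt (show i < n + 1 by omega)]

theorem exists_isSmallestAcc (h01 : wlt le w0 w1) : ∃ m, IsSmallestAcc le (supWords le) m :=
  h.exists_least (isClosed_setOf_isAccPt' _) ⟨_, h.isAccPt'_w10inf h01⟩

end IsCylOrder

/-! ### Substitutions -/

theorem listApply_append (f : Sub2) (l l' : List Bool) :
    listApply f (l ++ l') = listApply f l ++ listApply f l' := by
  simp [listApply]

theorem length_le_length_listApply {f : Sub2} (hf : ∀ b, 1 ≤ (f b).length) (l : List Bool) :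
    l.length ≤ (listApply f l).length := by
  induction l with
  | nil => simp
  | cons b l ih =>
    have := hf b
    simp only [listApply, List.map_cons, List.flatten_cons, List.length_append,
      List.length_cons] at ih ⊢
    omega

theorem subApply_eq_getD {f : Sub2} (hf : ∀ b, 1 ≤ (f b).length) (a : W2) {n m : ℕ}
    (hm : n < m) :
    subApply f a n = (listApply f (List.ofFn fun i : Fin m => a i.val)).getD n false := by
  induction m, hm using Nat.le_induction with
  | base => rfl
  | succ m hm ih =>
    rw [ih, List.ofFn_succ_last, listApply_append, List.getD_append]
    · rfl
    · have := length_le_length_listApply hf (List.ofFn fun i : Fin m => a i.val)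
      rw [List.length_ofFn] at this
      exact lt_of_lt_of_le hm this

section Tau

variable (j k : ℕ)

theorem one_le_length_tauS (b : Bool) : 1 ≤ (tauS j k b).length := by simp [tauS]

theorem subApply_tauS_eq (a : W2) (n : ℕ) :
    subApply (tauS j k) a n =
      (tauS j k (a 0) ++
        listApply (tauS j k) (List.ofFn fun i : Fin (n + 1) => shiftn a 1 i.val)).getD n false := by
  rw [subApply_eq_getD (one_le_length_tauS j k) a (show n < n + 2 by omega), List.ofFn_succ]
  rfl

theorem startsZeros_subApply (a : W2) :
    StartsZeros (if a 0 then k else j) (subApply (tauS j k) a) := by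
  constructor
  · rw [subApply_tauS_eq]
    rfl
  · intro i h1 hi
    obtain ⟨p, rfl⟩ : ∃ p, i = p + 1 := ⟨i - 1, by omega⟩
    rw [subApply_tauS_eq, List.getD_append _ _ _ _ (by simp [tauS]; omega)]
    simp only [tauS, List.getD_cons_succ]
    rw [List.getD_replicate _ (by omega)]

theorem subApply_add (a : W2) (n : ℕ) :
    subApply (tauS j k) a (n + ((if a 0 then k else j) + 1)) =
      subApply (tauS j k) (shiftn a 1) n := by
  rw [subApply_tauS_eq, List.getD_append_right _ _ _ _ (by simp [tauS]),
    subApply_eq_getD (one_le_length_tauS j k) (shiftn a 1)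
      (show n < n + ((if a 0 then k else j) + 1) + 1 by omega)]
  congr 1
  simp [tauS]

theorem shiftn_subApply (a : W2) :
    shiftn (subApply (tauS j k) a) ((if a 0 then k else j) + 1) =
      subApply (tauS j k) (shiftn a 1) :=
  funext fun n => subApply_add j k a n

theorem subApply_zero (a : W2) : subApply (tauS j k) a 0 = true :=
  (startsZeros_subApply j k a).1

theorem startsBlock_subApply (a : W2) :
    StartsBlock (if a 0 then k else j) (subApply (tauS j k) a) := by
  refine ⟨startsZeros_subApply j k a, ?_⟩
  have := subApply_add j k a 0
  rw [Nat.zero_add] at this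
  rw [this, subApply_zero]

theorem Agree.subApply {f : Sub2} {n : ℕ} {a b : W2} (hab : Agree n a b) :
    Agree n (subApply f a) (subApply f b) := by
  intro i hi
  have : (fun p : Fin (i + 1) => a p.val) = fun p : Fin (i + 1) => b p.val :=
    funext fun p => hab p.val (by omega)
  unfold _root_.subApply
  rw [this]

theorem subApply_tail (a : W2) (i : ℕ) (hi : subApply (tauS j k) a i = true) :
    ∃ n, shiftn (subApply (tauS j k) a) i = subApply (tauS j k) (shiftn a n) := by
  induction i using Nat.strong_induction_on generalizing a with
  | _ i ih =>
    rcases Nat.eq_zero_or_pos i with rfl | hpos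
    · exact ⟨0, rfl⟩
    · rcases Nat.lt_or_ge i ((if a 0 then k else j) + 1) with hlt | hge
      · rw [(startsZeros_subApply j k a).2 i hpos (by omega)] at hi
        cases hi
      · obtain ⟨p, rfl⟩ := Nat.exists_eq_add_of_le' hge
        rw [subApply_add] at hi
        obtain ⟨n, hn⟩ := ih p (by omega) (shiftn a 1) hi
        refine ⟨n + 1, ?_⟩
        rw [← shiftn_shiftn, shiftn_subApply, hn, shiftn_shiftn]

theorem exists_subApply_shiftn (a : W2) (n : ℕ) :
    ∃ i, subApply (tauS j k) (shiftn a n) = shiftn (subApply (tauS j k) a) i := by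
  induction n generalizing a with
  | zero => exact ⟨0, rfl⟩
  | succ n ih =>
    obtain ⟨i, hi⟩ := ih (shiftn a 1)
    rw [shiftn_shiftn, ← shiftn_subApply, shiftn_shiftn] at hi
    exact ⟨_, hi⟩

variable {j k}

theorem exists_agree_subApply_iff (hjk : j < k) (a : W2) (n : ℕ) :
    ∃ p, ∀ b, Agree n a b ↔ Agree (p + 1) (subApply (tauS j k) a) (subApply (tauS j k) b) := by
  induction n generalizing a with
  | zero =>
    refine ⟨0, fun b => ⟨fun _ i hi => ?_, fun _ i hi => absurd hi (by omega)⟩⟩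
    obtain rfl : i = 0 := by omega
    rw [subApply_zero, subApply_zero]
  | succ n ih =>
    obtain ⟨p, hp⟩ := ih (shiftn a 1)
    refine ⟨p + ((if a 0 then k else j) + 1), fun b => ⟨fun hab i hi => ?_, fun hab => ?_⟩⟩
    · have h0 : a 0 = b 0 := hab 0 (by omega)
      have hT := (hp (shiftn b 1)).mp hab.shiftn
      have hZ := (startsZeros_subApply j k a).agree (h0 ▸ startsZeros_subApply j k b)
      rcases Nat.lt_or_ge i ((if a 0 then k else j) + 1) with hlt | hge
      · exact hZ i hlt
      · obtain ⟨q, rfl⟩ := Nat.exists_eq_add_of_le' hge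
        rw [subApply_add]
        conv_rhs => rw [h0, subApply_add]
        exact hT q (by omega)
    · have h0 : a 0 = b 0 := by
        have hb := startsBlock_subApply j k b
        have he : (if a 0 then k else j) = (if b 0 then k else j) :=
          ((startsBlock_subApply j k a).of_agree (hab.mono (by omega))).eq hb
        revert he
        cases a 0 <;> cases b 0 <;> simp <;> omega
      have hs : Agree n (shiftn a 1) (shiftn b 1) := by
        refine (hp _).mpr ?_
        rw [← shiftn_subApply, ← shiftn_subApply, ← h0]
        exact Agree.shiftn (hab.mono (by omega))
      intro i hi
      cases i with
      | zero => exact h0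
      | succ i => exact hs i (by omega)

theorem subApply_injective (hjk : j < k) : Function.Injective (subApply (tauS j k)) := by
  intro a b hab
  funext n
  obtain ⟨p, hp⟩ := exists_agree_subApply_iff hjk a (n + 1)
  exact (hp b).mpr (fun i _ => congrFun hab i) n (by omega)

theorem exists_subApply_eq {x : W2} (hx0 : x 0 = true)
    (hx : ∀ i, x i = true → StartsBlock j (shiftn x i) ∨ StartsBlock k (shiftn x i)) :
    ∃ a, subApply (tauS j k) a = x := by
  let len : W2 → ℕ := fun y => if decide (StartsBlock k y) then k else j
  let next : W2 → W2 := fun y => shiftn y (len y + 1)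
  let code : W2 → W2 := fun y n => decide (StartsBlock k (next^[n] y))
  have hcode : ∀ y, shiftn (code y) 1 = code (next y) := fun y => rfl
  refine ⟨code x, funext fun i => ?_⟩
  induction i using Nat.strong_induction_on generalizing x with
  | _ i ih =>
    have hb : StartsBlock (len x) x := by
      by_cases hk : StartsBlock k x
      · simp [len, hk]
      · simpa [len, hk, shiftn_zero] using (hx 0 hx0).resolve_right hk
    have hT : StartsBlock (len x) (subApply (tauS j k) (code x)) :=
      startsBlock_subApply j k (code x)
    rcases Nat.lt_or_ge i (len x + 1) with hlt | hge
    · exact hT.agree hb i (by omega)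
    · obtain ⟨p, rfl⟩ := Nat.exists_eq_add_of_le' hge
      have key := ih p (by omega) (x := next x) (by simpa [next, shiftn] using hb.2)
        (fun q hq => by simp only [next, shiftn_shiftn]; exact hx _ hq)
      have := subApply_add j k (code x) p
      rw [hcode, key] at this
      exact this

end Tau

/-! ### Renormalization -/

/-- The pullback of a relation on words along a substitution. -/
def pullOrder (le : W2 → W2 → Prop) (f : Sub2) : W2 → W2 → Prop :=
  fun a b => le (subApply f a) (subApply f b)

theorem IsSmallestAcc.unique {le : W2 → W2 → Prop} (h : IsCylOrder le) {M : Set W2} {x y : W2}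
    (hx : IsSmallestAcc le M x) (hy : IsSmallestAcc le M y) : x = y :=
  h.2.1 _ _ (hx.2 y hy.1) (hy.2 x hx.1)

namespace IsCylOrder

variable {le : W2 → W2 → Prop} (h : IsCylOrder le) {j k : ℕ}
include h

theorem pullOrder (hjk : j < k) : IsCylOrder (pullOrder le (tauS j k)) := by
  refine ⟨fun a b => h.1 _ _, fun a b hab hba => subApply_injective hjk (h.2.1 _ _ hab hba),
    fun a b c hab hbc => h.2.2.1 _ _ _ hab hbc, fun a b c hab hbc => ?_⟩
  rw [wdist_le_iff]
  intro n hac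
  obtain ⟨p, hp⟩ := exists_agree_subApply_iff hjk a n
  exact (hp b).mpr (h.agree_of_between hab hbc ((hp c).mp hac))

theorem wlt_pullOrder (hjk : j < k) (hj : BlockUp le j) :
    wlt (_root_.pullOrder le (tauS j k)) w0 w1 := by
  refine ⟨(h.lt_of_blockUp hj ?_ ?_).1, fun he => ?_⟩
  · simpa [w0] using startsBlock_subApply j k w0
  · have := (startsBlock_subApply j k w1).1.mono (m := j + 1) (by simpa [w1] using hjk)
    exact this
  · simpa [w0, w1] using congrFun he 0

theorem subApply_mem_supWords_iff (h01 : wlt le w0 w1) (hjk : j < k) (x : W2) :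
    subApply (tauS j k) x ∈ supWords le ↔ x ∈ supWords (_root_.pullOrder le (tauS j k)) := by
  rw [(h.pullOrder hjk).mem_supWords_iff]
  constructor
  · intro hx n
    obtain ⟨i, hi⟩ := exists_subApply_shiftn j k x n
    unfold _root_.pullOrder
    rw [hi]
    exact (h.mem_supWords_iff _).mp hx i
  · intro hx
    refine h.mem_supWords_of_tails h01 (subApply_zero j k x) fun i hi => ?_
    obtain ⟨n, hn⟩ := subApply_tail j k x i hi
    rw [hn]
    exact hx n

theorem isSmallestAcc_subApply (h01 : wlt le w0 w1) (hjk : j < k) (hj : BlockUp le j)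
    (hk : BlockUp le k) (hlow : ∀ i < k, i ≠ j → ¬ BlockUp le i) {m : W2}
    (hm : IsSmallestAcc (_root_.pullOrder le (tauS j k))
      (supWords (_root_.pullOrder le (tauS j k))) m) :
    IsSmallestAcc le (supWords le) (subApply (tauS j k) m) := by
  have h' := h.pullOrder hjk
  constructor
  · refine (isAccPt'_iff _ _).mpr fun n => ?_
    obtain ⟨y, hy, hne, hmy⟩ := (isAccPt'_iff _ _).mp hm.1 n
    exact ⟨_, (h.subApply_mem_supWords_iff h01 hjk y).mpr hy,
      fun he => hne (subApply_injective hjk he), hmy.subApply⟩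
  · intro y hy
    have hm0 : m 0 = true := h'.head_of_isAccPt' (h.wlt_pullOrder hjk hj) hm.1
    have hmk : StartsBlock k (subApply (tauS j k) m) := by
      simpa [hm0] using startsBlock_subApply j k m
    have hyj : ¬ StartsBlock j y := fun hyj =>
      h.not_isAccPt'_of_startsBlock hj (fun i hi => hlow i (by omega) (by omega)) hyj hy
    by_cases hyk : StartsBlock k y
    · have key : ∀ z ∈ supWords le, StartsBlock k z → ∃ a, subApply (tauS j k) a = z :=
        fun z hz hzk =>
          exists_subApply_eq hzk.1.1 (h.startsBlock_of_mem_supWords hk hlow hz hzk)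
      obtain ⟨a, rfl⟩ := key y (h.mem_supWords_of_isAccPt' hy) hyk
      refine hm.2 a ((isAccPt'_iff _ _).mpr fun n => ?_)
      obtain ⟨p, hp⟩ := exists_agree_subApply_iff hjk a n
      obtain ⟨z, hz, hne, hyz⟩ := (isAccPt'_iff _ _).mp hy (max (p + 1) (k + 2))
      obtain ⟨b, rfl⟩ := key z hz (hyk.of_agree (hyz.mono (le_max_right _ _)))
      exact ⟨b, (h.subApply_mem_supWords_iff h01 hjk b).mp hz, fun he => hne (he ▸ rfl),
        (hp b).mpr (hyz.mono (le_max_left _ _))⟩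
    · exact (h.lt_of_not_startsBlock hk hlow hmk (h.head_of_isAccPt' h01 hy) hyj hyk).1

theorem isSmallestAcc_w10inf_or_renormalize (h01 : wlt le w0 w1) :
    IsSmallestAcc le (supWords le) w10inf ∨
      ∃ f, memS f ∧ IsCylOrder (_root_.pullOrder le f) ∧ wlt (_root_.pullOrder le f) w0 w1 ∧
        ∀ m, IsSmallestAcc (_root_.pullOrder le f) (supWords (_root_.pullOrder le f)) m →
          IsSmallestAcc le (supWords le) (subApply f m) := by
  by_cases hex : ∃ j k, j < k ∧ BlockUp le j ∧ BlockUp le k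
  · right
    have hj : ∃ j, BlockUp le j := let ⟨j, _, _, hj, _⟩ := hex; ⟨j, hj⟩
    have hk : ∃ k, Nat.find hj < k ∧ BlockUp le k := by
      obtain ⟨j, k, hjk, hj', hk'⟩ := hex
      exact ⟨k, (Nat.find_min' hj hj').trans_lt hjk, hk'⟩
    have hjk := (Nat.find_spec hk).1
    refine ⟨_, ⟨_, _, hjk, rfl⟩, h.pullOrder hjk, h.wlt_pullOrder hjk (Nat.find_spec hj),
      fun m hm => h.isSmallestAcc_subApply h01 hjk (Nat.find_spec hj) (Nat.find_spec hk).2 ?_ hm⟩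
    intro i hi hne hup
    rcases lt_or_gt_of_ne hne with hlt | hgt
    · exact Nat.find_min hj hlt hup
    · exact Nat.find_min hk hi ⟨hgt, hup⟩
  · left
    refine ⟨h.isAccPt'_w10inf h01, fun y hy => ?_⟩
    rcases eq_w10inf_or_startsBlock (h.head_of_isAccPt' h01 hy) with rfl | ⟨n, hn⟩
    · exact h.refl _
    · refine (h.lt_of_not_blockUp (fun hup => ?_) hn (startsZeros_w10inf _)).1
      exact h.not_isAccPt'_of_startsBlock hup (fun i hi hi' => hex ⟨i, n, hi, hi', hup⟩) hn hy

end IsCylOrder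

theorem agree_applyList {L : List Sub2} (hL : ∀ f ∈ L, memS f) {a b : W2} (ha : a 0 = true)
    (hb : b 0 = true) :
    Agree (L.length + 1) (applyList L a) (applyList L b) ∧ applyList L a 0 = true := by
  induction L with
  | nil =>
    refine ⟨fun i hi => ?_, ha⟩
    obtain rfl : i = 0 := by simpa using hi
    exact ha.trans hb.symm
  | cons f L ih =>
    obtain ⟨hag, h0⟩ := ih fun g hg => hL g (List.mem_cons_of_mem f hg)
    obtain ⟨j, k, hjk, rfl⟩ := hL f List.mem_cons_self
    have h0' : applyList L b 0 = true := by rw [← hag 0 (by omega), h0]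
    refine ⟨fun i hi => ?_, subApply_zero j k (applyList L a)⟩
    change subApply (tauS j k) (applyList L a) i = subApply (tauS j k) (applyList L b) i
    rw [List.length_cons] at hi
    rcases Nat.lt_or_ge i (k + 1) with hlt | hge
    · refine StartsZeros.agree (n := k) ?_ ?_ i hlt
      · simpa [h0] using startsZeros_subApply j k (applyList L a)
      · simpa [h0'] using startsZeros_subApply j k (applyList L b)
    · obtain ⟨p, rfl⟩ := Nat.exists_eq_add_of_le' hge
      have ea := subApply_add j k (applyList L a) p
      have eb := subApply_add j k (applyList L b) p
      simp only [h0, h0', if_true] at ea eb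
      rw [ea, eb]
      exact (Agree.shiftn (n := L.length) (k := 1) hag).subApply p (by omega)

theorem compUpTo_succ (σ : ℕ → Sub2) (n : ℕ) (a : W2) :
    compUpTo σ (n + 1) a = compUpTo σ n (subApply (σ n) a) := by
  simp only [compUpTo, applyList, List.ofFn_succ_last, List.foldr_append]
  rfl

theorem isLimitWord_of_forall_compUpTo {σ : ℕ → Sub2} (hσ : ∀ n, memS (σ n)) {m : W2}
    (hm : ∀ n, ∃ a : W2, a 0 = true ∧ m = compUpTo σ n a) : IsLimitWord σ w1 m := by
  intro ε hε
  obtain ⟨N, hN⟩ := exists_pow_lt_of_lt_one hε (by norm_num : (2 : ℝ)⁻¹ < 1)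
  refine ⟨N, fun n hn => ((wdist_lt_iff _ _ N).mpr ?_).trans hN⟩
  obtain ⟨a, ha, rfl⟩ := hm n
  refine Agree.mono (agree_applyList (fun f hf => ?_) rfl ha).1 ?_
  · obtain ⟨i, rfl⟩ := List.mem_ofFn.mp hf
    exact hσ _
  · rw [List.length_ofFn]
    omega

/-- Let `≤` be a cylinder order on `{0,1}^∞` with `0^∞ < 1^∞`. Then either
`m_≤ = σ(10^∞)` for some `σ ∈ S*` (a finite, possibly empty, composition of elements
of `S`), or `m_≤ = lim_{n→∞} σ_{[1,n]}(1^∞)` for some `σ = (σ_n) ∈ S^∞`. -/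
theorem stmt_6 (le : W2 → W2 → Prop) (h : IsCylOrder le) (h01 : wlt le w0 w1) :
    ∃ m : W2, IsSmallestAcc le (supWords le) m ∧
      ((∃ L : List Sub2, (∀ f ∈ L, memS f) ∧ m = applyList L w10inf) ∨
        (∃ σ : ℕ → Sub2, (∀ n, memS (σ n)) ∧ IsLimitWord σ w1 m)) := by
  by_cases hfin : ∃ L : List Sub2, (∀ f ∈ L, memS f) ∧
      IsSmallestAcc le (supWords le) (applyList L w10inf)
  · obtain ⟨L, hL, hm⟩ := hfin
    exact ⟨_, hm, Or.inl ⟨L, hL, rfl⟩⟩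
  let State : Type := {r : W2 → W2 → Prop // IsCylOrder r ∧ wlt r w0 w1 ∧
    ¬ ∃ L : List Sub2, (∀ f ∈ L, memS f) ∧ IsSmallestAcc r (supWords r) (applyList L w10inf)}
  have step : ∀ r : State, ∃ (f : Sub2) (r' : State), memS f ∧
      ∀ m, IsSmallestAcc r'.1 (supWords r'.1) m →
        IsSmallestAcc r.1 (supWords r.1) (subApply f m) := by
    rintro ⟨r, hr, hr01, hrfin⟩
    rcases hr.isSmallestAcc_w10inf_or_renormalize hr01 with hm | ⟨f, hf, hc, hc01, hacc⟩
    · exact absurd ⟨[], by simp, hm⟩ hrfin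
    · refine ⟨f, ⟨pullOrder r f, hc, hc01, ?_⟩, hf, hacc⟩
      rintro ⟨L, hL, hm⟩
      refine hrfin ⟨f :: L, fun g hg => ?_, hacc _ hm⟩
      rcases List.mem_cons.mp hg with rfl | hg
      · exact hf
      · exact hL g hg
  choose sub next hsub hnext using step
  let st : ℕ → State := fun n => next^[n] ⟨le, h, h01, hfin⟩
  have hst : ∀ n, st (n + 1) = next (st n) := fun n => Function.iterate_succ_apply' _ _ _
  have hcomp : ∀ n m, IsSmallestAcc (st n).1 (supWords (st n).1) m →
      IsSmallestAcc le (supWords le) (compUpTo (fun i => sub (st i)) n m) := by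
    intro n
    induction n with
    | zero => exact fun m hm => hm
    | succ n ih =>
      intro m hm
      rw [compUpTo_succ]
      rw [hst] at hm
      exact ih _ (hnext _ _ hm)
  obtain ⟨m, hm⟩ := h.exists_isSmallestAcc h01
  refine ⟨m, hm, Or.inr ⟨fun i => sub (st i), fun n => hsub _,
    isLimitWord_of_forall_compUpTo (fun n => hsub _) fun n => ?_⟩⟩
  obtain ⟨a, ha⟩ := (st n).2.1.exists_isSmallestAcc (st n).2.2.1
  exact ⟨a, (st n).2.1.head_of_isAccPt' (st n).2.2.1 ha.1, hm.unique h (hcomp n a ha)⟩
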